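/- arXiv:1208.3637 — 11 statements merged into one kernel-verified Lean document; each statement's English description precedes it below -/
import Mathlib

section
/- Let A be the 15×15 adjacency matrix of the '4442 spoke' tree: a central vertex c together with four pairwise disjoint paths attached to c, consisting of 4, 4, 4 and 2 edges respectively. Then √(3+√5) is the largest eigenvalue of A: there exists a nonzero real vector v with A·v = √(3+√5)·v, and every real number μ admitting a nonzero vector w with A·w = μ·w satisfies |μ| ≤ √(3+√5). -/
open Matrix

/-- Edge list of the 4442 spoke tree: central vertex 0 with arms 1-2-3-4, 5-6-7-8, 9-10-11-12 (4 edges each) and 13-14 (2 edges). -/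
def edgesSpoke4442 : List (Fin 15 × Fin 15) :=
  [(0,1),(1,2),(2,3),(3,4),(0,5),(5,6),(6,7),(7,8),(0,9),(9,10),(10,11),(11,12),(0,13),(13,14)]

/-- Adjacency matrix: entry 1 if the vertices are joined by an edge, 0 otherwise. -/
def adjSpoke4442 : Matrix (Fin 15) (Fin 15) ℝ :=
  fun i j => if (i, j) ∈ edgesSpoke4442 ∨ (j, i) ∈ edgesSpoke4442 then 1 else 0

/-- **Collatz–Wielandt bound.** If a real matrix with nonnegative entries has a positive
eigenvector with eigenvalue `r`, then every real eigenvalue has absolute value at most `r`. -/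
theorem Matrix.abs_eigenvalue_le_of_pos_eigenvector {ι : Type*} [Fintype ι]
    {A : Matrix ι ι ℝ} (hA : ∀ i j, 0 ≤ A i j) {v : ι → ℝ} (hv : ∀ i, 0 < v i) {r : ℝ}
    (hAv : A *ᵥ v = r • v) {μ : ℝ} {w : ι → ℝ} (hw : w ≠ 0) (hAw : A *ᵥ w = μ • w) :
    |μ| ≤ r := by
  obtain ⟨k, hk⟩ := Function.ne_iff.mp hw
  have : Nonempty ι := ⟨k⟩
  obtain ⟨i, hi⟩ := Finite.exists_max fun j => |w j| / v j
  set M := |w i| / v i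
  have hle : ∀ j, |w j| ≤ M * v j := fun j => (div_le_iff₀ (hv j)).mp (hi j)
  have hwi : |w i| = M * v i := (div_mul_cancel₀ _ (hv i).ne').symm
  have hM_pos : 0 < M := (div_pos (abs_pos.mpr hk) (hv k)).trans_le (hi k)
  have hvi : ∑ j, A i j * v j = r * v i := congrFun hAv i
  have hwi' : ∑ j, A i j * w j = μ * w i := congrFun hAw i
  refine le_of_mul_le_mul_right ?_ (mul_pos hM_pos (hv i))
  calc |μ| * (M * v i) = |∑ j, A i j * w j| := by rw [hwi', abs_mul, hwi]
    _ ≤ ∑ j, |A i j * w j| := Finset.abs_sum_le_sum_abs _ _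
    _ ≤ ∑ j, A i j * (M * v j) := by
      gcongr with j
      rw [abs_mul, abs_of_nonneg (hA i j)]
      exact mul_le_mul_of_nonneg_left (hle j) (hA i j)
    _ = M * ∑ j, A i j * v j := by
      rw [Finset.mul_sum]
      exact Finset.sum_congr rfl fun j _ => by ring
    _ = r * (M * v i) := by rw [hvi]; ring

/-- The Perron–Frobenius eigenvector of the 4442 spoke tree, in terms of the eigenvalue `x`. -/
def perronSpoke4442 (x : ℝ) : Fin 15 → ℝ :=
  ![3 * (x ^ 2 - 1), x * (x ^ 2 - 2), x ^ 2 - 1, x, 1, x * (x ^ 2 - 2), x ^ 2 - 1, x, 1,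
    x * (x ^ 2 - 2), x ^ 2 - 1, x, 1, 3 * x, 3]

theorem perronSpoke4442_pos {x : ℝ} (hx : 0 < x) (hx2 : 2 < x ^ 2) (i : Fin 15) :
    0 < perronSpoke4442 x i := by
  have h1 : 0 < x ^ 2 - 1 := by linarith
  have h2 : 0 < x ^ 2 - 2 := by linarith
  fin_cases i <;> dsimp [perronSpoke4442] <;> positivity

theorem adjSpoke4442_mulVec_perronSpoke4442 {x : ℝ} (hx : x ^ 4 = 6 * x ^ 2 - 4) :
    adjSpoke4442 *ᵥ perronSpoke4442 x = x • perronSpoke4442 x := by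
  ext i
  fin_cases i <;>
    simp [Matrix.mulVec, dotProduct, Fin.sum_univ_succ, adjSpoke4442, edgesSpoke4442,
      perronSpoke4442] <;>
    linarith

theorem thmSpoke4442 :
    (∃ v : Fin 15 → ℝ, v ≠ 0 ∧ (adjSpoke4442).mulVec v = Real.sqrt (3 + Real.sqrt 5) • v) ∧
    (∀ (μ : ℝ) (w : Fin 15 → ℝ), w ≠ 0 → (adjSpoke4442).mulVec w = μ • w →
      |μ| ≤ Real.sqrt (3 + Real.sqrt 5)) := by
  have h5 : Real.sqrt 5 ^ 2 = 5 := Real.sq_sqrt (by norm_num)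
  have hsq : Real.sqrt (3 + Real.sqrt 5) ^ 2 = 3 + Real.sqrt 5 := Real.sq_sqrt (by positivity)
  have hpos := perronSpoke4442_pos (x := Real.sqrt (3 + Real.sqrt 5)) (by positivity)
    (by rw [hsq]; linarith [Real.sqrt_nonneg 5])
  have heig := adjSpoke4442_mulVec_perronSpoke4442 (x := Real.sqrt (3 + Real.sqrt 5))
    (by linear_combination (Real.sqrt (3 + Real.sqrt 5) ^ 2 + Real.sqrt 5 - 3) * hsq + h5)
  refine ⟨⟨_, fun h => (hpos 0).ne' (congrFun h 0), heig⟩, fun μ w hw hAw =>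
    Matrix.abs_eigenvalue_le_of_pos_eigenvector (fun i j => ?_) hpos heig hw hAw⟩
  unfold adjSpoke4442
  split_ifs <;> norm_num
end

section
/- Let A be the 8×8 adjacency matrix of the '2221 spoke' tree: a central vertex c together with four pairwise disjoint paths attached to c, consisting of 2, 2, 2 and 1 edges respectively. Then √((5+√21)/2) is the largest eigenvalue of A: there exists a nonzero real vector v with A·v = √((5+√21)/2)·v, and every real number μ admitting a nonzero vector w with A·w = μ·w satisfies |μ| ≤ √((5+√21)/2). -/
open Matrix

/-- Edge list of the 2221 spoke tree: central vertex 0 with arms of 2, 2, 2, 1 edges. -/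
def edgesSpoke2221 : List (Fin 8 × Fin 8) :=
  [(0,1),(1,2),(0,3),(3,4),(0,5),(5,6),(0,7)]

/-- Adjacency matrix: entry 1 if the vertices are joined by an edge, 0 otherwise. -/
def adjSpoke2221 : Matrix (Fin 8) (Fin 8) ℝ :=
  fun i j => if (i, j) ∈ edgesSpoke2221 ∨ (j, i) ∈ edgesSpoke2221 then 1 else 0

theorem adjSpoke2221_mulVec (v : Fin 8 → ℝ) :
    adjSpoke2221.mulVec v =
      ![v 1 + v 3 + v 5 + v 7, v 0 + v 2, v 1, v 0 + v 4, v 3, v 0 + v 6, v 5, v 0] := by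
  ext i
  fin_cases i <;>
    simp [Matrix.mulVec, dotProduct, Fin.sum_univ_eight, adjSpoke2221, edgesSpoke2221]

theorem adjSpoke2221_mulVec_eq_smul_iff (μ : ℝ) (v : Fin 8 → ℝ) :
    adjSpoke2221.mulVec v = μ • v ↔
      v 1 + v 3 + v 5 + v 7 = μ * v 0 ∧ v 0 + v 2 = μ * v 1 ∧ v 1 = μ * v 2 ∧
      v 0 + v 4 = μ * v 3 ∧ v 3 = μ * v 4 ∧ v 0 + v 6 = μ * v 5 ∧ v 5 = μ * v 6 ∧
      v 0 = μ * v 7 := by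
  rw [adjSpoke2221_mulVec, funext_iff]
  simp [Fin.forall_fin_succ]

/-- An eigenvalue whose square exceeds 1 is a root of `x ^ 4 - 5 * x ^ 2 + 1`. -/
theorem eigenvalue_adjSpoke2221_root {μ : ℝ} {w : Fin 8 → ℝ} (hw : w ≠ 0)
    (h : adjSpoke2221.mulVec w = μ • w) (hμ : 1 < μ ^ 2) :
    μ ^ 4 - 5 * μ ^ 2 + 1 = 0 := by
  obtain ⟨h0, h1, h2, h3, h4, h5, h6, h7⟩ := (adjSpoke2221_mulVec_eq_smul_iff μ w).1 h
  by_contra hne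
  have hsub : μ ^ 2 - 1 ≠ 0 := by linarith
  have hμ0 : μ ≠ 0 := by
    rintro rfl
    norm_num at hμ
  have arm {x y : ℝ} (hx : w 0 + y = μ * x) (hy : x = μ * y) : (μ ^ 2 - 1) * y = w 0 := by
    rw [hy] at hx
    linear_combination -hx
  have a2 := arm h1 h2
  have a4 := arm h3 h4
  have a6 := arm h5 h6
  have hc : w 0 = 0 := by
    refine (mul_eq_zero.1 ?_).resolve_left hne
    linear_combination (-μ * (μ ^ 2 - 1)) * h0 + μ * (μ ^ 2 - 1) * (h2 + h4 + h6) +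
      μ ^ 2 * (a2 + a4 + a6) - (μ ^ 2 - 1) * h7
  rw [hc] at a2 a4 a6 h7
  have e2 : w 2 = 0 := (mul_eq_zero.1 a2).resolve_left hsub
  have e4 : w 4 = 0 := (mul_eq_zero.1 a4).resolve_left hsub
  have e6 : w 6 = 0 := (mul_eq_zero.1 a6).resolve_left hsub
  have e7 : w 7 = 0 := (mul_eq_zero.1 h7.symm).resolve_left hμ0
  rw [e2, mul_zero] at h2
  rw [e4, mul_zero] at h4
  rw [e6, mul_zero] at h6
  apply hw
  ext i
  fin_cases i <;> assumption

theorem thmSpoke2221 :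
    (∃ v : Fin 8 → ℝ, v ≠ 0 ∧ (adjSpoke2221).mulVec v = Real.sqrt ((5 + Real.sqrt 21) / 2) • v) ∧
    (∀ (μ : ℝ) (w : Fin 8 → ℝ), w ≠ 0 → (adjSpoke2221).mulVec w = μ • w →
      |μ| ≤ Real.sqrt ((5 + Real.sqrt 21) / 2)) := by
  have h21 : Real.sqrt 21 ^ 2 = 21 := Real.sq_sqrt (by norm_num)
  have hs := Real.sqrt_nonneg 21
  set t := (5 + Real.sqrt 21) / 2 with ht
  have ht2 : t ^ 2 - 5 * t + 1 = 0 := by rw [ht]; linear_combination h21 / 4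
  have ht1 : 5 / 2 ≤ t := by rw [ht]; linarith
  have hr : Real.sqrt t ^ 2 = t := Real.sq_sqrt (by linarith)
  constructor
  · set r := Real.sqrt t
    refine ⟨![r * (r ^ 2 - 1), r ^ 2, r, r ^ 2, r, r ^ 2, r, r ^ 2 - 1], fun h => ?_, ?_⟩
    · have h1 : r ^ 2 = 0 := congrFun h 1
      linarith
    · rw [adjSpoke2221_mulVec_eq_smul_iff]
      refine ⟨?_, ?_, ?_, ?_, ?_, ?_, ?_, ?_⟩ <;> simp <;> try ring1
      linear_combination (-(r ^ 2) - t + 5) * hr - ht2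
  · intro μ w hw h
    refine Real.abs_le_sqrt (le_of_not_gt fun hlt => ?_)
    have hroot := eigenvalue_adjSpoke2221_root hw h (by linarith)
    nlinarith
end

section
/- Let A be the adjacency matrix of the graph obtained from the 4442 base graph by adding one new vertex w adjacent to both u₁ and u₂. Then A has an eigenvalue strictly larger than √(3+√5): there exist a real number μ > √(3+√5) and a nonzero real vector v with A·v = μ·v. -/
open Matrix

/-- 4442 base graph (path 0-1-2-3-4 with 5,6,7 adjacent to 4) plus a new vertex 8 adjacent to both 5 and 6. -/
def edgesMerge4442 : List (Fin 9 × Fin 9) :=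
  [(0,1),(1,2),(2,3),(3,4),(4,5),(4,6),(4,7),(5,8),(6,8)]

/-- Adjacency matrix: entry 1 if the vertices are joined by an edge, 0 otherwise. -/
def adjMerge4442 : Matrix (Fin 9) (Fin 9) ℝ :=
  fun i j => if (i, j) ∈ edgesMerge4442 ∨ (j, i) ∈ edgesMerge4442 then 1 else 0

/-- The characteristic equation of the symmetric eigenvectors of `adjMerge4442` has a solution whose
value is at least `2.3`. -/
lemma exists_root_merge4442 : ∃ μ : ℝ, 2.3 ≤ μ ∧
    (μ ^ 4 - 3 * μ ^ 2 + 1) * (μ ^ 4 - 5 * μ ^ 2 + 2) - μ ^ 2 * (μ ^ 2 - 2) ^ 2 = 0 := by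
  have hcont : ContinuousOn (fun μ : ℝ =>
      (μ ^ 4 - 3 * μ ^ 2 + 1) * (μ ^ 4 - 5 * μ ^ 2 + 2) - μ ^ 2 * (μ ^ 2 - 2) ^ 2)
      (Set.Icc 2.3 2.5) := by fun_prop
  obtain ⟨μ, hμ, h⟩ := intermediate_value_Icc (by norm_num) hcont
    (show (0 : ℝ) ∈ Set.Icc _ _ by constructor <;> norm_num)
  exact ⟨μ, hμ.1, h⟩

lemma sqrt_three_add_sqrt_five_lt : Real.sqrt (3 + Real.sqrt 5) < 2.3 := by
  have h : Real.sqrt 5 < 2.25 := (Real.sqrt_lt' (by norm_num)).2 (by norm_num)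
  rw [Real.sqrt_lt' (by norm_num)]
  linarith

theorem thmMerge4442 :
    ∃ μ : ℝ, μ > Real.sqrt (3 + Real.sqrt 5) ∧
      ∃ v : Fin 9 → ℝ, v ≠ 0 ∧ (adjMerge4442).mulVec v = μ • v := by
  obtain ⟨μ, hμ, hroot⟩ := exists_root_merge4442
  refine ⟨μ, sqrt_three_add_sqrt_five_lt.trans_le hμ,
    ![μ * (μ ^ 2 - 2), μ ^ 2 * (μ ^ 2 - 2), μ * (μ ^ 2 - 1) * (μ ^ 2 - 2),
      μ ^ 2 * (μ ^ 2 - 2) ^ 2, μ * (μ ^ 2 - 2) * (μ ^ 4 - 3 * μ ^ 2 + 1),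
      μ ^ 2 * (μ ^ 4 - 3 * μ ^ 2 + 1), μ ^ 2 * (μ ^ 4 - 3 * μ ^ 2 + 1),
      (μ ^ 2 - 2) * (μ ^ 4 - 3 * μ ^ 2 + 1), 2 * μ * (μ ^ 4 - 3 * μ ^ 2 + 1)], ?_, ?_⟩
  · intro h
    have h0 : μ * (μ ^ 2 - 2) = 0 := congrFun h 0
    have hpos : 0 < μ * (μ ^ 2 - 2) := mul_pos (by linarith) (by nlinarith)
    exact hpos.ne' h0
  · ext i
    fin_cases i <;>
      simp [Matrix.mulVec, dotProduct, Fin.sum_univ_succ, adjMerge4442, edgesMerge4442] <;>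
      first | ring1 | linear_combination (-1 : ℝ) * hroot
end

section
/- Let A be the adjacency matrix of the graph obtained from the extended 4442 base graph by adding one new vertex x adjacent to both w₁ and w₂. Then A has an eigenvalue strictly larger than √(3+√5): there exist a real number μ > √(3+√5) and a nonzero real vector v with A·v = μ·v. -/
open Matrix

/-- Extended 4442 base graph plus a new vertex 11 adjacent to both 8 and 9. -/
def edgesMergeExt4442 : List (Fin 12 × Fin 12) :=
  [(0,1),(1,2),(2,3),(3,4),(4,5),(4,6),(4,7),(5,8),(6,9),(7,10),(8,11),(9,11)]

/-- Adjacency matrix: entry 1 if the vertices are joined by an edge, 0 otherwise. -/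
def adjMergeExt4442 : Matrix (Fin 12) (Fin 12) ℝ :=
  fun i j => if (i, j) ∈ edgesMergeExt4442 ∨ (j, i) ∈ edgesMergeExt4442 then 1 else 0

/-- The Perron eigenvalue of the merged graph is the square root of a root of this quintic. -/
lemma exists_root_quintic : ∃ t : ℝ, t ∈ Set.Icc (5.3 : ℝ) 5.4 ∧
    t * (t - 1) ^ 2 * (t - 3) ^ 2 - (t ^ 2 - 3 * t + 1) * (3 * t ^ 2 - 9 * t + 4) = 0 := by
  have hcont : ContinuousOn (fun t : ℝ => t * (t - 1) ^ 2 * (t - 3) ^ 2 -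
      (t ^ 2 - 3 * t + 1) * (3 * t ^ 2 - 9 * t + 4)) (Set.Icc 5.3 5.4) := by fun_prop
  exact intermediate_value_Icc (by norm_num) hcont ⟨by norm_num, by norm_num⟩

theorem thmMergeExt4442 :
    ∃ μ : ℝ, μ > Real.sqrt (3 + Real.sqrt 5) ∧
      ∃ v : Fin 12 → ℝ, v ≠ 0 ∧ (adjMergeExt4442).mulVec v = μ • v := by
  obtain ⟨t, ⟨ht, -⟩, hroot⟩ := exists_root_quintic
  obtain ⟨m, hm, rfl⟩ : ∃ m : ℝ, 0 < m ∧ m ^ 2 = t :=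
    ⟨√t, Real.sqrt_pos.2 (by linarith), Real.sq_sqrt (by linarith)⟩
  refine ⟨m, ?_, ![m * (m ^ 2 - 1) * (m ^ 2 - 3),
    m * (m * (m ^ 2 - 1) * (m ^ 2 - 3)),
    (m ^ 2 - 1) * (m * (m ^ 2 - 1) * (m ^ 2 - 3)),
    (m ^ 3 - 2 * m) * (m * (m ^ 2 - 1) * (m ^ 2 - 3)),
    (m ^ 4 - 3 * m ^ 2 + 1) * (m * (m ^ 2 - 1) * (m ^ 2 - 3)),
    (m ^ 4 - 3 * m ^ 2 + 1) * ((m ^ 2 - 1) * (m ^ 2 - 2)),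
    (m ^ 4 - 3 * m ^ 2 + 1) * ((m ^ 2 - 1) * (m ^ 2 - 2)),
    (m ^ 4 - 3 * m ^ 2 + 1) * ((m ^ 2 - 3) * m ^ 2),
    (m ^ 4 - 3 * m ^ 2 + 1) * ((m ^ 2 - 1) * m),
    (m ^ 4 - 3 * m ^ 2 + 1) * ((m ^ 2 - 1) * m),
    (m ^ 4 - 3 * m ^ 2 + 1) * ((m ^ 2 - 3) * m),
    (m ^ 4 - 3 * m ^ 2 + 1) * (2 * (m ^ 2 - 1))], ?_, ?_⟩
  · have h5 : √5 < 2.3 := (Real.sqrt_lt' (by norm_num)).2 (by norm_num)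
    exact (Real.sqrt_lt' hm).2 (by linarith)
  · intro h
    have hpos : 0 < m * (m ^ 2 - 1) * (m ^ 2 - 3) :=
      mul_pos (mul_pos hm (by linarith)) (by linarith)
    exact hpos.ne' (congrFun h 0)
  · ext i
    fin_cases i <;>
      simp [Matrix.mulVec, dotProduct, Fin.sum_univ_succ, adjMergeExt4442,
        edgesMergeExt4442] <;>
      first
      | ring1
      | linear_combination -hroot
end

section
/- Let A be the adjacency matrix of the graph obtained from the extended 4442 base graph by adding two new vertices x and x′, each adjacent to w₁. Then A has an eigenvalue strictly larger than √(3+√5): there exist a real number μ > √(3+√5) and a nonzero real vector v with A·v = μ·v. -/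
open Matrix

/-- Extended 4442 base graph plus new vertices 11 and 12, each adjacent to 8. -/
def edgesSplitExt4442 : List (Fin 13 × Fin 13) :=
  [(0,1),(1,2),(2,3),(3,4),(4,5),(4,6),(4,7),(5,8),(6,9),(7,10),(8,11),(8,12)]

/-- Adjacency matrix: entry 1 if the vertices are joined by an edge, 0 otherwise. -/
def adjSplitExt4442 : Matrix (Fin 13) (Fin 13) ℝ :=
  fun i j => if (i, j) ∈ edgesSplitExt4442 ∨ (j, i) ∈ edgesSplitExt4442 then 1 else 0

/-- The factor of the characteristic polynomial of `adjSplitExt4442` whose largest root is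
the norm of the graph, as a polynomial in the square of the eigenvalue. -/
def charSplitExt4442 (s : ℝ) : ℝ :=
  s * (s - 1) ^ 2 * (s - 3) ^ 2 - (s ^ 2 - 3 * s + 1) * (3 * s ^ 2 - 9 * s + 2)

/-- The eigenvector of `adjSplitExt4442` for an eigenvalue `t` with `charSplitExt4442 (t ^ 2) = 0`,
obtained by solving the eigenvalue equation along the branches of the tree. -/
def eigvecSplitExt4442 (t : ℝ) : Fin 13 → ℝ :=
  let c := t * (t ^ 2 - 1) * (t ^ 2 - 3)
  let p := t ^ 4 - 3 * t ^ 2 + 1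
  ![c, t * c, (t ^ 2 - 1) * c, (t ^ 3 - 2 * t) * c, p * c,
    p * (t ^ 2 - 2) * (t ^ 2 - 1), t ^ 2 * p * (t ^ 2 - 3), t ^ 2 * p * (t ^ 2 - 3),
    t * p * (t ^ 2 - 1), t * p * (t ^ 2 - 3), t * p * (t ^ 2 - 3),
    p * (t ^ 2 - 1), p * (t ^ 2 - 1)]

theorem adjSplitExt4442_mulVec_eigvec {t : ℝ} (h : charSplitExt4442 (t ^ 2) = 0) :
    adjSplitExt4442.mulVec (eigvecSplitExt4442 t) = t • eigvecSplitExt4442 t := by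
  unfold charSplitExt4442 at h
  ext i
  fin_cases i <;>
    simp [Matrix.mulVec, dotProduct, Fin.sum_univ_succ, adjSplitExt4442, edgesSplitExt4442,
      eigvecSplitExt4442] <;>
    first
      | ring1
      | linear_combination -h

theorem charSplitExt4442_three_add_sqrt_five : charSplitExt4442 (3 + √5) = -2 := by
  have h : (√5) ^ 2 = (5 : ℝ) := Real.sq_sqrt (by norm_num)
  have hs : (3 + √5) ^ 2 = 6 * (3 + √5) - 4 := by linear_combination h
  unfold charSplitExt4442
  generalize 3 + √5 = s at hs
  have h3 : s ^ 3 = 32 * s - 24 := by linear_combination (s + 6) * hs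
  have h4 : s ^ 4 = 168 * s - 128 := by linear_combination s * h3 + 32 * hs
  have h5 : s ^ 5 = 880 * s - 672 := by linear_combination s * h4 + 168 * hs
  linear_combination h5 - 11 * h4 + 40 * h3 - 56 * hs

theorem exists_charSplitExt4442_root :
    ∃ t : ℝ, √(3 + √5) < t ∧ charSplitExt4442 (t ^ 2) = 0 := by
  have h5 : √5 ≤ (3 : ℝ) := Real.sqrt_le_iff.2 (by norm_num)
  have h3 : √(3 + √5) ≤ 3 := Real.sqrt_le_iff.2 ⟨by norm_num, by linarith⟩
  have hcont : ContinuousOn (fun t : ℝ => charSplitExt4442 (t ^ 2)) (Set.Icc (√(3 + √5)) 3) := by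
    unfold charSplitExt4442
    fun_prop
  have hmem : (0 : ℝ) ∈ Set.Ioc (charSplitExt4442 (√(3 + √5) ^ 2)) (charSplitExt4442 (3 ^ 2)) := by
    rw [Real.sq_sqrt (by positivity), charSplitExt4442_three_add_sqrt_five]
    norm_num [charSplitExt4442]
  obtain ⟨t, ht, hzero⟩ := intermediate_value_Ioc h3 hcont hmem
  exact ⟨t, ht.1, hzero⟩

theorem thmSplitExt4442 :
    ∃ μ : ℝ, μ > Real.sqrt (3 + Real.sqrt 5) ∧
      ∃ v : Fin 13 → ℝ, v ≠ 0 ∧ (adjSplitExt4442).mulVec v = μ • v := by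
  obtain ⟨t, ht, hF⟩ := exists_charSplitExt4442_root
  have h5 : 5 < t ^ 2 := by
    have h2 : (2 : ℝ) < √5 := Real.lt_sqrt_of_sq_lt (by norm_num)
    have := (Real.sqrt_lt' ((Real.sqrt_nonneg _).trans_lt ht)).1 ht
    linarith
  have ht0 : 0 < t := (Real.sqrt_nonneg _).trans_lt ht
  refine ⟨t, ht, eigvecSplitExt4442 t, fun h => ?_, adjSplitExt4442_mulVec_eigvec hF⟩
  have h0 : t * (t ^ 2 - 1) * (t ^ 2 - 3) = 0 := congrFun h 0
  have : 0 < t * (t ^ 2 - 1) * (t ^ 2 - 3) :=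
    mul_pos (mul_pos ht0 (by linarith)) (by linarith)
  exact this.ne' h0
end

section
/- Let A be the adjacency matrix of the graph obtained from the doubly extended 4442 base graph by adding one new vertex y adjacent to both x₂ and x₃. Then A has an eigenvalue strictly larger than √(3+√5): there exist a real number μ > √(3+√5) and a nonzero real vector v with A·v = μ·v. -/
open Matrix

/-- Doubly extended 4442 base graph plus a new vertex 13 adjacent to both 11 and 12. -/
def edgesMergeDExt4442 : List (Fin 14 × Fin 14) :=
  [(0,1),(1,2),(2,3),(3,4),(4,5),(4,6),(4,7),(5,8),(6,9),(7,10),(9,11),(10,12),(11,13),(12,13)]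

/-- Adjacency matrix: entry 1 if the vertices are joined by an edge, 0 otherwise. -/
def adjMergeDExt4442 : Matrix (Fin 14) (Fin 14) ℝ :=
  fun i j => if (i, j) ∈ edgesMergeDExt4442 ∨ (j, i) ∈ edgesMergeDExt4442 then 1 else 0

/-- Clearing denominators in the eigenvalue equation at the central vertex, for vectors invariant
under the reflection swapping the two merged arms, gives this polynomial condition on the
eigenvalue. -/
lemma exists_root_mergeDExt4442 :
    ∃ m : ℝ, 23 / 10 < m ∧
      m * ((m ^ 4 - 3 * m ^ 2 + 1) * (m ^ 2 - 1) * (m ^ 4 - 4 * m ^ 2 + 2)) =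
        (m ^ 3 - 2 * m) * ((m ^ 2 - 1) * (m ^ 4 - 4 * m ^ 2 + 2)) +
        m * ((m ^ 4 - 3 * m ^ 2 + 1) * (m ^ 4 - 4 * m ^ 2 + 2)) +
        2 * ((m ^ 3 - 3 * m) * ((m ^ 4 - 3 * m ^ 2 + 1) * (m ^ 2 - 1))) := by
  let f : ℝ → ℝ := fun m =>
    m * ((m ^ 4 - 3 * m ^ 2 + 1) * (m ^ 2 - 1) * (m ^ 4 - 4 * m ^ 2 + 2)) -
      ((m ^ 3 - 2 * m) * ((m ^ 2 - 1) * (m ^ 4 - 4 * m ^ 2 + 2)) +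
        m * ((m ^ 4 - 3 * m ^ 2 + 1) * (m ^ 4 - 4 * m ^ 2 + 2)) +
        2 * ((m ^ 3 - 3 * m) * ((m ^ 4 - 3 * m ^ 2 + 1) * (m ^ 2 - 1))))
  have hf : ContinuousOn f (Set.Icc (23 / 10) (231 / 100)) := by fun_prop
  obtain ⟨m, hm, h⟩ := intermediate_value_Ioo (by norm_num) hf
    (show (0 : ℝ) ∈ Set.Ioo (f (23 / 10)) (f (231 / 100)) by constructor <;> norm_num [f])
  exact ⟨m, hm.1, sub_eq_zero.mp h⟩

theorem thmMergeDExt4442 :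
    ∃ μ : ℝ, μ > Real.sqrt (3 + Real.sqrt 5) ∧
      ∃ v : Fin 14 → ℝ, v ≠ 0 ∧ (adjMergeDExt4442).mulVec v = μ • v := by
  obtain ⟨m, hm, h⟩ := exists_root_mergeDExt4442
  have h5 : Real.sqrt 5 < 229 / 100 := by
    rw [Real.sqrt_lt' (by norm_num)]
    norm_num
  have hlower : Real.sqrt (3 + Real.sqrt 5) < 23 / 10 := by
    rw [Real.sqrt_lt' (by norm_num)]
    linarith
  refine ⟨m, hlower.trans hm, ?_⟩
  obtain ⟨A, hA⟩ : ∃ A, A = m ^ 4 - 3 * m ^ 2 + 1 := ⟨_, rfl⟩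
  obtain ⟨B, hB⟩ : ∃ B, B = m ^ 2 - 1 := ⟨_, rfl⟩
  obtain ⟨C, hC⟩ : ∃ C, C = m ^ 4 - 4 * m ^ 2 + 2 := ⟨_, rfl⟩
  rw [← hA, ← hB, ← hC] at h
  have hB0 : 0 < B := by rw [hB]; nlinarith
  have hC0 : 0 < C := by
    have hsq : 5 < m ^ 2 := by nlinarith
    rw [hC]
    nlinarith
  refine ⟨![B * C, m * (B * C), (m ^ 2 - 1) * (B * C), (m ^ 3 - 2 * m) * (B * C), A * B * C,
    m * (A * C), (m ^ 3 - 3 * m) * (A * B), (m ^ 3 - 3 * m) * (A * B), A * C,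
    (m ^ 2 - 2) * (A * B), (m ^ 2 - 2) * (A * B), m * (A * B), m * (A * B), 2 * (A * B)],
    fun hv => (mul_pos hB0 hC0).ne' (congrFun hv 0), ?_⟩
  ext i
  fin_cases i <;>
    simp [adjMergeDExt4442, edgesMergeDExt4442, mulVec, dotProduct, Fin.sum_univ_succ]
  all_goals first | ring1 | linear_combination -h | (subst hA hB hC; ring1)
end

section
/- Let A be the adjacency matrix of the graph obtained from the doubly extended 4442 base graph by adding two new vertices y and y′, each adjacent to x₂. Then A has an eigenvalue strictly larger than √(3+√5): there exist a real number μ > √(3+√5) and a nonzero real vector v with A·v = μ·v. -/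
open Matrix

/-- Doubly extended 4442 base graph plus new vertices 13 and 14, each adjacent to 11. -/
def edgesSplitDExt4442 : List (Fin 15 × Fin 15) :=
  [(0,1),(1,2),(2,3),(3,4),(4,5),(4,6),(4,7),(5,8),(6,9),(7,10),(9,11),(10,12),(11,13),(11,14)]

/-- Adjacency matrix: entry 1 if the vertices are joined by an edge, 0 otherwise. -/
def adjSplitDExt4442 : Matrix (Fin 15) (Fin 15) ℝ :=
  fun i j => if (i, j) ∈ edgesSplitDExt4442 ∨ (j, i) ∈ edgesSplitDExt4442 then 1 else 0

/-- The numerator of the secular equation at the branch vertex `4`, as a polynomial in the square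
`s` of the eigenvalue. -/
def secularSplitDExt4442 (s : ℝ) : ℝ :=
  s * (s ^ 2 - 3 * s + 1) * (s - 1) * (s - 2) * (s ^ 2 - 4 * s + 2)
    - s * (s - 2) ^ 2 * (s - 1) * (s ^ 2 - 4 * s + 2)
    - s * (s ^ 2 - 3 * s + 1) * (s - 2) * (s ^ 2 - 4 * s + 2)
    - (s - 1) ^ 2 * (s ^ 2 - 3 * s + 1) * (s ^ 2 - 4 * s + 2)
    - s * (s - 3) * (s ^ 2 - 3 * s + 1) * (s - 1) * (s - 2)

/-- The vector obtained by solving the eigenvalue equation for `m` along each arm, from the leaves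
towards the branch vertex `4`. -/
def vecSplitDExt4442 (m : ℝ) : Fin 15 → ℝ :=
  let p := m ^ 4 - 3 * m ^ 2 + 1
  let r := m ^ 2 - 1
  let d := m ^ 2 - 2
  let q := m ^ 4 - 4 * m ^ 2 + 2
  ![m * r * d * q, m * (m * r * d * q), r * (m * r * d * q), m * d * (m * r * d * q),
    m * p * r * d * q,
    m * (m * p * d * q), (m ^ 3 - 3 * m) * (m * p * r * d), r * (p * r * q),
    m * p * d * q, d * (m * p * r * d), m * (p * r * q),
    m * (m * p * r * d), p * r * q, m * p * r * d, m * p * r * d]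

theorem mulVec_vecSplitDExt4442 {m : ℝ} (hm : secularSplitDExt4442 (m ^ 2) = 0) :
    adjSplitDExt4442 *ᵥ vecSplitDExt4442 m = m • vecSplitDExt4442 m := by
  unfold secularSplitDExt4442 at hm
  ext i
  fin_cases i <;>
    simp [Matrix.mulVec, dotProduct, Fin.sum_univ_succ, adjSplitDExt4442, edgesSplitDExt4442,
      vecSplitDExt4442] <;>
    first
    | ring1
    | linear_combination -hm

theorem exists_secularSplitDExt4442_eq_zero :
    ∃ s : ℝ, 21 / 4 ≤ s ∧ secularSplitDExt4442 s = 0 := by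
  have hcont : ContinuousOn secularSplitDExt4442 (Set.Icc (21 / 4) 6) := by
    unfold secularSplitDExt4442
    fun_prop
  have hzero : (0 : ℝ) ∈
      Set.Icc (secularSplitDExt4442 (21 / 4)) (secularSplitDExt4442 6) := by
    constructor <;> norm_num [secularSplitDExt4442]
  obtain ⟨s, hs, hs0⟩ := intermediate_value_Icc (by norm_num) hcont hzero
  exact ⟨s, hs.1, hs0⟩

theorem thmSplitDExt4442 :
    ∃ μ : ℝ, μ > Real.sqrt (3 + Real.sqrt 5) ∧
      ∃ v : Fin 15 → ℝ, v ≠ 0 ∧ (adjSplitDExt4442).mulVec v = μ • v := by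
  obtain ⟨s, hs, hs0⟩ := exists_secularSplitDExt4442_eq_zero
  have hsq : √s ^ 2 = s := Real.sq_sqrt (by linarith)
  refine ⟨√s, ?_, vecSplitDExt4442 √s, ?_, mulVec_vecSplitDExt4442 (by rw [hsq, hs0])⟩
  · have h5 : √5 < 9 / 4 := (Real.sqrt_lt' (by norm_num)).2 (by norm_num)
    exact Real.sqrt_lt_sqrt (by positivity) (by linarith)
  · intro h
    have h0 : √s * (√s ^ 2 - 1) * (√s ^ 2 - 2) * (√s ^ 4 - 4 * √s ^ 2 + 2) = 0 :=
      congrFun h 0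
    have hpos : 0 < √s := Real.sqrt_pos.2 (by linarith)
    rw [show √s ^ 4 = (√s ^ 2) ^ 2 by ring, hsq] at h0
    have h1 : 0 < s - 1 := by linarith
    have h2 : 0 < s - 2 := by linarith
    have h3 : 0 < s ^ 2 - 4 * s + 2 := by nlinarith
    exact absurd h0 (by positivity)
end

section
/- Let A be the adjacency matrix of the graph obtained from the 3333 base graph by adding one new vertex w adjacent to both u₁ and u₂. Then A has an eigenvalue strictly larger than √(3+√5): there exist a real number μ > √(3+√5) and a nonzero real vector v with A·v = μ·v. -/
open Matrix

/-- 3333 base graph (path 0-1-2-3 with 4,5,6 adjacent to 3) plus a new vertex 7 adjacent to both 4 and 5. -/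
def edgesMerge3333 : List (Fin 8 × Fin 8) :=
  [(0,1),(1,2),(2,3),(3,4),(3,5),(3,6),(4,7),(5,7)]

/-- Adjacency matrix: entry 1 if the vertices are joined by an edge, 0 otherwise. -/
def adjMerge3333 : Matrix (Fin 8) (Fin 8) ℝ :=
  fun i j => if (i, j) ∈ edgesMerge3333 ∨ (j, i) ∈ edgesMerge3333 then 1 else 0

theorem thmMerge3333 :
    ∃ μ : ℝ, μ > Real.sqrt (3 + Real.sqrt 5) ∧
      ∃ v : Fin 8 → ℝ, v ≠ 0 ∧ (adjMerge3333).mulVec v = μ • v := by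
  have h6 : Real.sqrt 6 ^ 2 = 6 := Real.sq_sqrt (by norm_num)
  have hsq : Real.sqrt (3 + Real.sqrt 6) ^ 2 = 3 + Real.sqrt 6 := Real.sq_sqrt (by positivity)
  have hlt : Real.sqrt (3 + Real.sqrt 5) < Real.sqrt (3 + Real.sqrt 6) := by
    have h56 : Real.sqrt 5 < Real.sqrt 6 := Real.sqrt_lt_sqrt (by norm_num) (by norm_num)
    exact Real.sqrt_lt_sqrt (by positivity) (by linarith)
  generalize Real.sqrt (3 + Real.sqrt 6) = μ at hsq hlt
  have hquartic : μ ^ 4 - 6 * μ ^ 2 + 3 = 0 := by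
    linear_combination (μ ^ 2 + Real.sqrt 6 - 3) * hsq + h6
  refine ⟨μ, hlt, ![1, μ, μ ^ 2 - 1, μ ^ 3 - 2 * μ, μ ^ 2, μ ^ 2, μ ^ 2 - 2, 2 * μ], ?_, ?_⟩
  · intro h
    simpa using congrFun h 0
  · ext i
    fin_cases i <;>
      simp [Matrix.mulVec, dotProduct, Fin.sum_univ_eight, adjMerge3333, edgesMerge3333] <;>
      first
        | ring1
        | linear_combination -hquartic
end

section
/- Let A be the adjacency matrix of the graph obtained from the 3333 base graph by adding two new vertices w and w′, each adjacent to u₁. Then A has an eigenvalue strictly larger than √(3+√3): there exist a real number μ > √(3+√3) and a nonzero real vector v with A·v = μ·v. -/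
open Matrix

/-- 3333 base graph plus new vertices 7 and 8, each adjacent to 4. -/
def edgesSplit3333 : List (Fin 9 × Fin 9) :=
  [(0,1),(1,2),(2,3),(3,4),(3,5),(3,6),(4,7),(4,8)]

/-- Adjacency matrix: entry 1 if the vertices are joined by an edge, 0 otherwise. -/
def adjSplit3333 : Matrix (Fin 9) (Fin 9) ℝ :=
  fun i j => if (i, j) ∈ edgesSplit3333 ∨ (j, i) ∈ edgesSplit3333 then 1 else 0

theorem thmSplit3333 :
    ∃ μ : ℝ, μ > Real.sqrt (3 + Real.sqrt 3) ∧
      ∃ v : Fin 9 → ℝ, v ≠ 0 ∧ (adjSplit3333).mulVec v = μ • v := by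
  have hs : Real.sqrt 5 * Real.sqrt 5 = 5 := Real.mul_self_sqrt (by norm_num)
  refine ⟨Real.sqrt 5, ?_, ![1, Real.sqrt 5, 4, 3 * Real.sqrt 5, 5, 3, 3, Real.sqrt 5, Real.sqrt 5],
    fun h => one_ne_zero (congrFun h 0), ?_⟩
  · have h3 : Real.sqrt 3 < 2 := by
      rw [Real.sqrt_lt' (by norm_num)]
      norm_num
    exact Real.sqrt_lt_sqrt (by positivity) (by linarith)
  · ext i
    fin_cases i <;>
      simp [adjSplit3333, edgesSplit3333, Matrix.mulVec, dotProduct, Fin.sum_univ_succ] <;>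
      linarith
end

section
/- Let A be the adjacency matrix of the graph obtained from the 2221 base graph by adding one new vertex w adjacent to both u₁ and u₂. Then A has an eigenvalue strictly larger than √((5+√21)/2): there exist a real number μ > √((5+√21)/2) and a nonzero real vector v with A·v = μ·v. -/
open Matrix

/-- 2221 base graph (path 0-1-2 with 3,4,5 adjacent to 2) plus a new vertex 6 adjacent to both 3 and 4. -/
def edgesMerge2221 : List (Fin 7 × Fin 7) :=
  [(0,1),(1,2),(2,3),(2,4),(2,5),(3,6),(4,6)]

/-- Adjacency matrix: entry 1 if the vertices are joined by an edge, 0 otherwise. -/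
def adjMerge2221 : Matrix (Fin 7) (Fin 7) ℝ :=
  fun i j => if (i, j) ∈ edgesMerge2221 ∨ (j, i) ∈ edgesMerge2221 then 1 else 0

/-- If `μ ^ 2` is a root of `x ^ 3 - 7 * x ^ 2 + 9 * x - 2`, then `adjMerge2221` has an explicit
`μ`-eigenvector, symmetric in the vertices 3 and 4. -/
theorem adjMerge2221_mulVec_eq_smul {μ : ℝ}
    (hμ : (μ ^ 2) ^ 3 - 7 * (μ ^ 2) ^ 2 + 9 * μ ^ 2 - 2 = 0) :
    let v : Fin 7 → ℝ := ![μ * (μ ^ 2 - 2), μ ^ 2 * (μ ^ 2 - 2), μ * (μ ^ 2 - 1) * (μ ^ 2 - 2),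
      μ ^ 2 * (μ ^ 2 - 1), μ ^ 2 * (μ ^ 2 - 1), (μ ^ 2 - 1) * (μ ^ 2 - 2), 2 * μ * (μ ^ 2 - 1)]
    adjMerge2221.mulVec v = μ • v := by
  intro v
  ext i
  fin_cases i <;>
    simp [v, Matrix.mulVec, dotProduct, Fin.sum_univ_succ, adjMerge2221, edgesMerge2221]
  all_goals first | ring1 | linear_combination -hμ

/-- The cubic `x ^ 3 - 7 * x ^ 2 + 9 * x - 2` has a root in `[5, 6]`. -/
theorem exists_root_cubic_mem_Icc :
    ∃ x ∈ Set.Icc (5 : ℝ) 6, x ^ 3 - 7 * x ^ 2 + 9 * x - 2 = 0 := by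
  have hf : ContinuousOn (fun x : ℝ => x ^ 3 - 7 * x ^ 2 + 9 * x - 2) (Set.Icc 5 6) := by
    fun_prop
  exact intermediate_value_Icc (by norm_num) hf ⟨by norm_num, by norm_num⟩

theorem thmMerge2221 :
    ∃ μ : ℝ, μ > Real.sqrt ((5 + Real.sqrt 21) / 2) ∧
      ∃ v : Fin 7 → ℝ, v ≠ 0 ∧ (adjMerge2221).mulVec v = μ • v := by
  obtain ⟨x, ⟨hx, -⟩, hroot⟩ := exists_root_cubic_mem_Icc
  have hsq : √x ^ 2 = x := Real.sq_sqrt (by linarith)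
  refine ⟨√x, ?_, _, ?_, adjMerge2221_mulVec_eq_smul (by rwa [hsq])⟩
  · have h21 : √(21 : ℝ) < 5 := by
      rw [Real.sqrt_lt' (by norm_num)]
      norm_num
    exact Real.sqrt_lt_sqrt (by positivity) (by linarith)
  · intro h
    have h3 := congrFun h 3
    simp only [hsq] at h3
    have : x * (x - 1) = 0 := h3
    nlinarith
end

section
/- Let A be the adjacency matrix of the graph obtained from the 2221 base graph by adding two new vertices w and w′, each adjacent to u₁. Then A has an eigenvalue strictly larger than √((5+√21)/2): there exist a real number μ > √((5+√21)/2) and a nonzero real vector v with A·v = μ·v. -/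
open Matrix

/-- 2221 base graph plus new vertices 6 and 7, each adjacent to 3. -/
def edgesSplit2221 : List (Fin 8 × Fin 8) :=
  [(0,1),(1,2),(2,3),(2,4),(2,5),(3,6),(3,7)]

/-- Adjacency matrix: entry 1 if the vertices are joined by an edge, 0 otherwise. -/
def adjSplit2221 : Matrix (Fin 8) (Fin 8) ℝ :=
  fun i j => if (i, j) ∈ edgesSplit2221 ∨ (j, i) ∈ edgesSplit2221 then 1 else 0

/-- The cubic satisfied by the square of the graph norm has a root above `24 / 5`. -/
lemma exists_root_cubicSplit2221 :
    ∃ t : ℝ, 24 / 5 ≤ t ∧ t ^ 3 - 7 * t ^ 2 + 11 * t - 4 = 0 := by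
  have hcont : ContinuousOn (fun t : ℝ => t ^ 3 - 7 * t ^ 2 + 11 * t - 4)
      (Set.Icc (24 / 5) 5) := by fun_prop
  obtain ⟨t, ht, h⟩ := intermediate_value_Icc (by norm_num) hcont
    (show (0 : ℝ) ∈ Set.Icc _ _ by constructor <;> norm_num)
  exact ⟨t, ht.1, h⟩

theorem thmSplit2221 :
    ∃ μ : ℝ, μ > Real.sqrt ((5 + Real.sqrt 21) / 2) ∧
      ∃ v : Fin 8 → ℝ, v ≠ 0 ∧ (adjSplit2221).mulVec v = μ • v := by
  obtain ⟨t, ht, hroot⟩ := exists_root_cubicSplit2221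
  have hsq : Real.sqrt t ^ 2 = t := Real.sq_sqrt (by linarith)
  refine ⟨Real.sqrt t, ?_, ?_⟩
  · have h21 : Real.sqrt 21 < 23 / 5 := by
      rw [Real.sqrt_lt' (by norm_num)]
      norm_num
    exact Real.sqrt_lt_sqrt (by positivity) (by linarith)
  · generalize Real.sqrt t = μ at hsq
    subst hsq
    refine ⟨![μ * (μ ^ 2 - 2), μ ^ 2 * (μ ^ 2 - 2), μ * (μ ^ 2 - 1) * (μ ^ 2 - 2),
      μ ^ 2 * (μ ^ 2 - 1), (μ ^ 2 - 1) * (μ ^ 2 - 2), (μ ^ 2 - 1) * (μ ^ 2 - 2),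
      μ * (μ ^ 2 - 1), μ * (μ ^ 2 - 1)], ?_, ?_⟩
    · intro h
      have h4 : (μ ^ 2 - 1) * (μ ^ 2 - 2) = 0 := congrFun h 4
      nlinarith
    · ext i
      fin_cases i <;>
        simp [Matrix.mulVec, dotProduct, Fin.sum_univ_succ, adjSplit2221, edgesSplit2221] <;>
        first | ring1 | linear_combination -hroot
end
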